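/- Let G be a metric complete graph on n vertices where k is even, k ≥ 4, and k divides n. Let P*_k = {P_1, …, P_{n/k}} be a maximum-weight k-path packing, where P_i = v_{i1} v_{i2} ⋯ v_{ik}, and let M_{n/2} = ∪_i {v_{i(2j-1)} v_{i(2j)} : 1 ≤ j ≤ k/2} be the perfect matching formed by the odd-position edges of these paths. Then w(C*_k) ≥ ((k-2)/(k-1))·w(P*_k) + (2/(k-1))·w(M_{n/2}). -/

import Mathlib

open Finset

/-- Total weight of the `k`-cycle packing represented by a bijection
`f : Fin m × Fin k ≃ Fin n` (cycle `i` visits `f (i,0), f (i,1), …, f (i,k-1)` cyclically). -/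
noncomputable def cycleW {n m k : ℕ} (w : Fin n → Fin n → ℝ) (f : Fin m × Fin k ≃ Fin n) : ℝ :=
  ∑ i : Fin m, ∑ j : Fin k, w (f (i, j)) (f (i, finRotate k j))

/-- Total weight of the `k`-path packing represented by a bijection
`f : Fin m × Fin k ≃ Fin n` (path `i` is `f (i,0), f (i,1), …, f (i,k-1)`). -/
noncomputable def pathW {n m k : ℕ} (w : Fin n → Fin n → ℝ) (f : Fin m × Fin k ≃ Fin n) : ℝ :=
  ∑ i : Fin m, ∑ j : Fin k,
    if (j : ℕ) + 1 < k then w (f (i, j)) (f (i, finRotate k j)) else 0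

/-- Weight of the Hamiltonian cycle represented by the vertex ordering `g : Fin n ≃ Fin n`. -/
noncomputable def hamW {n : ℕ} (w : Fin n → Fin n → ℝ) (g : Fin n ≃ Fin n) : ℝ :=
  ∑ j : Fin n, w (g j) (g (finRotate n j))

/-- `w̃` of a `k`-path packing: the total weight of the odd-position edges
`(v_{i1},v_{i2}), (v_{i3},v_{i4}), …` of each path. -/
noncomputable def tildeW {n m k : ℕ} (w : Fin n → Fin n → ℝ) (f : Fin m × Fin k ≃ Fin n) : ℝ :=
  ∑ i : Fin m, ∑ j : Fin k,
    if (j : ℕ) % 2 = 0 then w (f (i, j)) (f (i, finRotate k j)) else 0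

/-- Weight of a matching of size `p`, given by the endpoints `x (i,0)`, `x (i,1)` of each edge. -/
noncomputable def matchW {n p : ℕ} (w : Fin n → Fin n → ℝ) (x : Fin p × Fin 2 → Fin n) : ℝ :=
  ∑ i : Fin p, w (x (i, 0)) (x (i, 1))

/-- Reversal of the positions `c, …, K`, keeping the positions below `c`. -/
def reverseTail (K c x : ℕ) : ℕ := if x < c then x else K + c - x

/-- `reverseTail` as a permutation of `Fin (K + 1)`. -/
def reverseTailPerm (K c : ℕ) : Equiv.Perm (Fin (K + 1)) :=
  Function.Involutive.toPerm
    (fun x => ⟨reverseTail K c x, by have := x.2; unfold reverseTail; split_ifs <;> omega⟩)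
    (by
      intro x
      have := x.2
      ext
      simp only [reverseTail]
      split_ifs <;> omega)

lemma sum_finRotate (K : ℕ) (F : Fin (K + 1) → Fin (K + 1) → ℝ) :
    ∑ j, F j (finRotate (K + 1) j) =
      ∑ j : Fin K, F j.castSucc j.succ + F (Fin.last K) 0 := by
  rw [Fin.sum_univ_castSucc]
  simp

lemma sum_reverseTail (d : ℕ → ℕ → ℝ) (hs : ∀ x y, d x y = d y x) (j r : ℕ) :
    ∑ x ∈ range (2 * (j + 1 + r) + 1),
        d (reverseTail (2 * (j + 1 + r) + 1) (2 * j + 2) x)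
          (reverseTail (2 * (j + 1 + r) + 1) (2 * j + 2) (x + 1)) =
      ∑ x ∈ range (2 * (j + 1 + r) + 1), d x (x + 1) - d (2 * j + 1) (2 * j + 2)
        + d (2 * j + 1) (2 * (j + 1 + r) + 1) := by
  have hsplit : ∀ g : ℕ → ℝ, ∑ x ∈ range (2 * (j + 1 + r) + 1), g x =
      ∑ x ∈ range (2 * j + 1), g x + g (2 * j + 1)
        + ∑ x ∈ range (2 * r + 1), g (2 * j + 2 + x) := by
    intro g
    rw [show 2 * (j + 1 + r) + 1 = 2 * j + 2 + (2 * r + 1) by ring, sum_range_add,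
      sum_range_succ g (2 * j + 1)]
  rw [hsplit, hsplit]
  have hhead : ∑ x ∈ range (2 * j + 1),
        d (reverseTail (2 * (j + 1 + r) + 1) (2 * j + 2) x)
          (reverseTail (2 * (j + 1 + r) + 1) (2 * j + 2) (x + 1)) =
      ∑ x ∈ range (2 * j + 1), d x (x + 1) := by
    refine sum_congr rfl fun x hx => ?_
    rw [mem_range] at hx
    rw [reverseTail, reverseTail, if_pos (by omega), if_pos (by omega)]
  have htail : ∑ x ∈ range (2 * r + 1),
        d (reverseTail (2 * (j + 1 + r) + 1) (2 * j + 2) (2 * j + 2 + x))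
          (reverseTail (2 * (j + 1 + r) + 1) (2 * j + 2) (2 * j + 2 + x + 1)) =
      ∑ x ∈ range (2 * r + 1), d (2 * j + 2 + x) (2 * j + 2 + x + 1) := by
    rw [← sum_range_reflect]
    refine sum_congr rfl fun x hx => ?_
    rw [mem_range] at hx
    rw [hs, reverseTail, reverseTail, if_neg (by omega), if_neg (by omega)]
    congr 1 <;> omega
  have hmid : d (reverseTail (2 * (j + 1 + r) + 1) (2 * j + 2) (2 * j + 1))
      (reverseTail (2 * (j + 1 + r) + 1) (2 * j + 2) (2 * j + 1 + 1)) =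
      d (2 * j + 1) (2 * (j + 1 + r) + 1) := by
    rw [reverseTail, reverseTail, if_pos (by omega), if_neg (by omega)]
    congr 1; omega
  rw [hhead, htail, hmid]
  ring

lemma sum_range_odd_split (g : ℕ → ℝ) (s : ℕ) :
    ∑ x ∈ range (2 * s + 1), g x =
      ∑ j ∈ range (s + 1), g (2 * j) + ∑ j ∈ range s, g (2 * j + 1) := by
  induction s with
  | zero => simp
  | succ s ih =>
    rw [show 2 * (s + 1) + 1 = 2 * s + 1 + 1 + 1 by ring, sum_range_succ, sum_range_succ, ih,
      sum_range_succ (fun j => g (2 * j)) (s + 1), sum_range_succ (fun j => g (2 * j + 1)) s,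
      show 2 * (s + 1) = 2 * s + 1 + 1 by ring]
    ring

lemma sum_even_edges_le_aux (d : ℕ → ℕ → ℝ) (hs : ∀ x y, d x y = d y x)
    (ht : ∀ x y z, d x z ≤ d x y + d y z) (K t : ℕ) :
    ∑ j ∈ range (t + 1), d (2 * j) (2 * j + 1) ≤
      (t + 1) * d 0 K + ∑ j ∈ range t, d 0 (2 * j + 2)
        + ∑ j ∈ range (t + 1), d (2 * j + 1) K := by
  induction t with
  | zero =>
    have h1 := ht 0 K 1
    have h2 := hs K 1
    simp only [zero_add, sum_range_one, mul_zero, range_zero, sum_empty, Nat.cast_zero]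
    linarith
  | succ t ih =>
    rw [sum_range_succ, sum_range_succ (fun j => d 0 (2 * j + 2)) t,
      sum_range_succ (fun j => d (2 * j + 1) K) (t + 1)]
    have h1 := ht (2 * (t + 1)) 0 (2 * (t + 1) + 1)
    have h2 := ht 0 K (2 * (t + 1) + 1)
    have h3 := hs (2 * (t + 1)) 0
    have h4 := hs K (2 * (t + 1) + 1)
    rw [show 2 * t + 2 = 2 * (t + 1) by ring]
    push_cast
    linarith

lemma sum_even_edges_le (d : ℕ → ℕ → ℝ) (hs : ∀ x y, d x y = d y x)
    (ht : ∀ x y z, d x z ≤ d x y + d y z) (s : ℕ) (h1s : 1 ≤ s) :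
    ∑ j ∈ range (s + 1), d (2 * j) (2 * j + 1) ≤
      (s + 1) * d 0 (2 * s + 1)
        + ∑ j ∈ range s, (d 0 (2 * j + 2) + d (2 * j + 1) (2 * s + 1)) := by
  obtain ⟨t, rfl⟩ := Nat.exists_eq_add_of_le' h1s
  have h := sum_even_edges_le_aux d hs ht (2 * (t + 1) + 1) t
  rw [sum_add_distrib, sum_range_succ, sum_range_succ (fun j => d 0 (2 * j + 2)) t]
  have h1 := ht (2 * (t + 1)) 0 (2 * (t + 1) + 1)
  have h2 := hs (2 * (t + 1)) 0
  rw [show 2 * t + 2 = 2 * (t + 1) by ring]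
  push_cast
  linarith

/-- Distance between the vertices at positions `x` and `y` of the `i`-th path. -/
def posDist {n m K : ℕ} (w : Fin n → Fin n → ℝ) (f : Fin m × Fin (K + 1) ≃ Fin n)
    (i : Fin m) (x y : ℕ) : ℝ :=
  w (f (i, Fin.ofNat (K + 1) x)) (f (i, Fin.ofNat (K + 1) y))

lemma posDist_val {n m K : ℕ} (w : Fin n → Fin n → ℝ) (f : Fin m × Fin (K + 1) ≃ Fin n)
    (i : Fin m) (x y : Fin (K + 1)) : posDist w f i x y = w (f (i, x)) (f (i, y)) := by
  simp [posDist]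

lemma pathW_eq {n m K : ℕ} (w : Fin n → Fin n → ℝ) (f : Fin m × Fin (K + 1) ≃ Fin n) :
    pathW w f = ∑ i, ∑ x ∈ range K, posDist w f i x (x + 1) := by
  refine sum_congr rfl fun i _ => ?_
  rw [sum_finRotate K
    (fun a b => if (a : ℕ) + 1 < K + 1 then w (f (i, a)) (f (i, b)) else 0)]
  simp only [Fin.val_castSucc, Fin.val_last, lt_irrefl, if_false, add_zero]
  rw [← Fin.sum_univ_eq_sum_range]
  refine sum_congr rfl fun x _ => ?_
  rw [if_pos (by simp), ← posDist_val w f i]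
  simp

lemma tildeW_eq {n m s : ℕ} (w : Fin n → Fin n → ℝ)
    (f : Fin m × Fin (2 * s + 1 + 1) ≃ Fin n) :
    tildeW w f = ∑ i, ∑ j ∈ range (s + 1), posDist w f i (2 * j) (2 * j + 1) := by
  refine sum_congr rfl fun i _ => ?_
  rw [sum_finRotate (2 * s + 1)
    (fun a b => if (a : ℕ) % 2 = 0 then w (f (i, a)) (f (i, b)) else 0)]
  have h : ∑ x : Fin (2 * s + 1),
      (if (x.castSucc : ℕ) % 2 = 0 then w (f (i, x.castSucc)) (f (i, x.succ)) else 0) =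
      ∑ x ∈ range (2 * s + 1), if x % 2 = 0 then posDist w f i x (x + 1) else 0 := by
    rw [← Fin.sum_univ_eq_sum_range
      (fun x => if x % 2 = 0 then posDist w f i x (x + 1) else 0)]
    refine sum_congr rfl fun x _ => ?_
    rw [← posDist_val w f i]
    simp
  rw [h, sum_range_odd_split]
  simp [Nat.add_mod]

lemma cycleW_perm {n m K : ℕ} (w : Fin n → Fin n → ℝ) (f : Fin m × Fin (K + 1) ≃ Fin n)
    (σ : Equiv.Perm (Fin (K + 1))) (p : ℕ → ℕ) (hp : ∀ x, (σ x : ℕ) = p x) :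
    cycleW w (((Equiv.refl (Fin m)).prodCongr σ).trans f) =
      ∑ i, (∑ x ∈ range K, posDist w f i (p x) (p (x + 1)) + posDist w f i (p K) (p 0)) := by
  refine sum_congr rfl fun i _ => ?_
  rw [sum_finRotate K (fun a b => w (((Equiv.refl (Fin m)).prodCongr σ).trans f (i, a))
    (((Equiv.refl (Fin m)).prodCongr σ).trans f (i, b)))]
  rw [← Fin.sum_univ_eq_sum_range (fun x => posDist w f i (p x) (p (x + 1)))]
  congr 1
  · refine sum_congr rfl fun x _ => ?_
    have h1 := hp x.castSucc
    have h2 := hp x.succ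
    rw [Fin.val_castSucc] at h1
    rw [Fin.val_succ] at h2
    rw [← h1, ← h2, posDist_val]
    rfl
  · have h1 := hp (Fin.last K)
    have h2 := hp 0
    rw [Fin.val_last] at h1
    rw [Fin.val_zero] at h2
    rw [← h1, ← h2, posDist_val]
    rfl

/-- In a metric complete graph on `n = m * k` vertices with `k` even, `k ≥ 4`,
let `P*_k` be a maximum-weight `k`-path packing and let `M_{n/2}` be the perfect matching
formed by the odd-position edges of its paths (whose weight is `w̃(P*_k)`). Then
`w(C*_k) ≥ ((k-2)/(k-1))·w(P*_k) + (2/(k-1))·w(M_{n/2})` for a maximum-weight `k`-cycle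
packing `C*_k`. -/
theorem stmt10 (n k m : ℕ) (hkeven : Even k) (hk : 4 ≤ k) (hn : n = m * k)
    (w : Fin n → Fin n → ℝ)
    (hnonneg : ∀ u v, 0 ≤ w u v) (hsymm : ∀ u v, w u v = w v u)
    (htri : ∀ u x v, w u v ≤ w u x + w x v)
    (Pstar : Fin m × Fin k ≃ Fin n)
    (hPmax : ∀ P : Fin m × Fin k ≃ Fin n, pathW w P ≤ pathW w Pstar)
    (Cstar : Fin m × Fin k ≃ Fin n)
    (hCmax : ∀ C : Fin m × Fin k ≃ Fin n, cycleW w C ≤ cycleW w Cstar) :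
    cycleW w Cstar ≥
      (((k : ℝ) - 2) / ((k : ℝ) - 1)) * pathW w Pstar +
        (2 / ((k : ℝ) - 1)) * tildeW w Pstar := by
  obtain ⟨s, hs, rfl⟩ : ∃ s, 1 ≤ s ∧ k = 2 * s + 1 + 1 := by
    obtain ⟨t, ht⟩ := hkeven
    exact ⟨t - 1, by omega, by omega⟩
  have dsymm : ∀ i x y, posDist w Pstar i x y = posDist w Pstar i y x :=
    fun i x y => hsymm _ _
  have dtri : ∀ i x y z, posDist w Pstar i x z ≤ posDist w Pstar i x y + posDist w Pstar i y z :=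
    fun i x y z => htri _ _ _
  have hclose : pathW w Pstar + ∑ i, posDist w Pstar i 0 (2 * s + 1) ≤ cycleW w Cstar := by
    refine le_trans (le_of_eq ?_)
      (hCmax (((Equiv.refl (Fin m)).prodCongr (Equiv.refl _)).trans Pstar))
    rw [cycleW_perm w Pstar (Equiv.refl _) id fun x => rfl, pathW_eq, ← sum_add_distrib]
    exact sum_congr rfl fun i _ => by rw [dsymm i 0]; rfl
  have hcut : ∀ j ∈ range s, pathW w Pstar + ∑ i, (posDist w Pstar i 0 (2 * j + 2)
      + posDist w Pstar i (2 * j + 1) (2 * s + 1) - posDist w Pstar i (2 * j + 1) (2 * j + 2))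
      ≤ cycleW w Cstar := by
    intro j hj
    rw [mem_range] at hj
    obtain ⟨r, rfl⟩ : ∃ r, s = j + 1 + r := ⟨s - (j + 1), by omega⟩
    refine le_trans (le_of_eq ?_)
      (hCmax (((Equiv.refl (Fin m)).prodCongr
        (reverseTailPerm (2 * (j + 1 + r) + 1) (2 * j + 2))).trans Pstar))
    rw [cycleW_perm w Pstar (reverseTailPerm (2 * (j + 1 + r) + 1) (2 * j + 2))
      (reverseTail (2 * (j + 1 + r) + 1) (2 * j + 2)) fun x => rfl, pathW_eq, ← sum_add_distrib]
    refine sum_congr rfl fun i _ => ?_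
    rw [sum_reverseTail _ (dsymm i)]
    have h1 : reverseTail (2 * (j + 1 + r) + 1) (2 * j + 2) (2 * (j + 1 + r) + 1) = 2 * j + 2 := by
      rw [reverseTail, if_neg (by omega)]; omega
    have h2 : reverseTail (2 * (j + 1 + r) + 1) (2 * j + 2) 0 = 0 := by
      rw [reverseTail, if_pos (by omega)]
    rw [h1, h2, dsymm i (2 * j + 2) 0]
    ring
  have hsum := sum_le_sum hcut
  rw [sum_add_distrib, sum_comm, sum_const, sum_const, card_range, nsmul_eq_mul, nsmul_eq_mul]
    at hsum
  have hsplit : pathW w Pstar = tildeW w Pstar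
      + ∑ i, ∑ j ∈ range s, posDist w Pstar i (2 * j + 1) (2 * j + 2) := by
    rw [pathW_eq, tildeW_eq, ← sum_add_distrib]
    exact sum_congr rfl fun i _ =>
      sum_range_odd_split (fun x => posDist w Pstar i x (x + 1)) s
  have htilde : tildeW w Pstar ≤ (s + 1) * ∑ i, posDist w Pstar i 0 (2 * s + 1)
      + ∑ i, ∑ j ∈ range s, (posDist w Pstar i 0 (2 * j + 2)
        + posDist w Pstar i (2 * j + 1) (2 * s + 1)) := by
    rw [tildeW_eq, mul_sum, ← sum_add_distrib]
    exact sum_le_sum fun i _ => sum_even_edges_le _ (dsymm i) (dtri i) s hs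
  simp only [sum_sub_distrib] at hsum
  have hmul := mul_le_mul_of_nonneg_left hclose (by positivity : (0 : ℝ) ≤ s + 1)
  have hpos : (0 : ℝ) < 2 * s + 1 := by positivity
  have hgoal : 2 * s * pathW w Pstar + 2 * tildeW w Pstar ≤ (2 * s + 1) * cycleW w Cstar := by
    linarith
  have hk2 : (((2 * s + 1 + 1 : ℕ) : ℝ) - 2) = 2 * s := by push_cast; ring
  have hk1 : (((2 * s + 1 + 1 : ℕ) : ℝ) - 1) = 2 * s + 1 := by push_cast; ring
  rw [hk2, hk1, ge_iff_le, div_mul_eq_mul_div, div_mul_eq_mul_div, ← add_div, div_le_iff₀ hpos]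
  linarith
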